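/- Let $m\ge 2$ and let $C_i = C^{(i,i+1),m}_{t^i_1,t^i_2}$ and $C_{i+1} = C^{(i+1,i+2),m}_{t^{i+1}_1,t^{i+1}_2}$ (built from the transpositions $(i,i+1)$ and $(i+1,i+2)$ with shift data in $\{0,\ldots,m-1\}$). Then $C_i$ and $C_{i+1}$ satisfy the braid relation $C_iC_{i+1}C_i = C_{i+1}C_iC_{i+1}$ if and only if $C_i^2$ and $C_{i+1}^2$ agree on the block $\mathrm{supp}(A^m_{i+1})$, if and only if $t^i_1 + t^i_2 \equiv t^{i+1}_1 + t^{i+1}_2 \pmod m$. -/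

import Mathlib

/-- Let `m ≥ 2` and let `C₁ = C^{(i,i+1),m}_{t₁,t₂}` and `C₂ = C^{(i+1,i+2),m}_{u₁,u₂}`
be the block permutations built from the block transpositions `(i,i+1)` and `(i+1,i+2)`
with shift data in `{0,…,m-1}`: `C₁` sends `a^i_q ↦ a^{i+1}_{(q+t₂) % m}` and
`a^{i+1}_q ↦ a^i_{(q+t₁) % m}` (with `a^i_q = 1+m(i-1)+q`), fixing everything else,
and similarly for `C₂` on blocks `i+1, i+2`.  Then `C₁` and `C₂` satisfy the braid
relation `C₁C₂C₁ = C₂C₁C₂` iff `C₁²` and `C₂²` agree on the block `supp(A^m_{i+1})`,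
iff `t₁ + t₂ ≡ u₁ + u₂ (mod m)`. -/
theorem blockTransposition_braid_iff (m i : ℕ) (hm : 2 ≤ m) (hi : 1 ≤ i)
    (t1 t2 u1 u2 : ℕ) (ht1 : t1 < m) (ht2 : t2 < m) (hu1 : u1 < m) (hu2 : u2 < m)
    (C1 C2 : Equiv.Perm ℕ)
    (hC1a : ∀ q, q < m → C1 (1 + m * (i - 1) + q) = 1 + m * i + (q + t2) % m)
    (hC1b : ∀ q, q < m → C1 (1 + m * i + q) = 1 + m * (i - 1) + (q + t1) % m)
    (hC1fix : ∀ x, (∀ q, q < m → x ≠ 1 + m * (i - 1) + q ∧ x ≠ 1 + m * i + q) →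
      C1 x = x)
    (hC2a : ∀ q, q < m → C2 (1 + m * i + q) = 1 + m * (i + 1) + (q + u2) % m)
    (hC2b : ∀ q, q < m → C2 (1 + m * (i + 1) + q) = 1 + m * i + (q + u1) % m)
    (hC2fix : ∀ x, (∀ q, q < m → x ≠ 1 + m * i + q ∧ x ≠ 1 + m * (i + 1) + q) →
      C2 x = x) :
    ((C1 * C2 * C1 = C2 * C1 * C2) ↔
      (∀ q, q < m → (C1 * C1) (1 + m * i + q) = (C2 * C2) (1 + m * i + q))) ∧
    ((C1 * C2 * C1 = C2 * C1 * C2) ↔ (t1 + t2) % m = (u1 + u2) % m) := by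
  have hm0 : 0 < m := by omega
  obtain ⟨j, rfl⟩ : ∃ j, i = j + 1 := ⟨i - 1, by omega⟩
  simp only [Nat.add_sub_cancel] at *
  have e1 : m * (j + 1) = m * j + m := by ring
  have e2 : m * (j + 1 + 1) = m * j + m + m := by ring
  simp only [e1, e2] at hC1a hC1b hC1fix hC2a hC2b hC2fix ⊢
  clear e1 e2
  generalize m * j = b at *
  have a1 : ∀ q, C1 (1 + b + q % m) = 1 + (b + m) + (q + t2) % m := fun q => by
    rw [hC1a _ (Nat.mod_lt _ hm0), Nat.mod_add_mod]
  have b1 : ∀ q, C1 (1 + (b + m) + q % m) = 1 + b + (q + t1) % m := fun q => by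
    rw [hC1b _ (Nat.mod_lt _ hm0), Nat.mod_add_mod]
  have f1 : ∀ q, C1 (1 + (b + m + m) + q % m) = 1 + (b + m + m) + q % m := fun q =>
    hC1fix _ (fun r hr => by constructor <;> omega)
  have a2 : ∀ q, C2 (1 + (b + m) + q % m) = 1 + (b + m + m) + (q + u2) % m := fun q => by
    rw [hC2a _ (Nat.mod_lt _ hm0), Nat.mod_add_mod]
  have b2 : ∀ q, C2 (1 + (b + m + m) + q % m) = 1 + (b + m) + (q + u1) % m := fun q => by
    rw [hC2b _ (Nat.mod_lt _ hm0), Nat.mod_add_mod]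
  have f2 : ∀ q, C2 (1 + b + q % m) = 1 + b + q % m := fun q => by
    have := Nat.mod_lt q hm0
    exact hC2fix _ (fun r hr => by constructor <;> omega)
  have key : ∀ q, (t1 + t2) % m = (u1 + u2) % m → (q + t1 + t2) % m = (q + u2 + u1) % m := by
    intro q h
    have h' : t1 + t2 ≡ u1 + u2 [MOD m] := h
    have := h'.add_left q
    rw [show q + u2 + u1 = q + (u1 + u2) by ring, add_assoc]
    exact this
  have sq : (∀ q, q < m → (C1 * C1) (1 + (b + m) + q) = (C2 * C2) (1 + (b + m) + q)) ↔
      (t1 + t2) % m = (u1 + u2) % m := by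
    constructor
    · intro h
      have h0 := h (0 % m) (Nat.mod_lt _ hm0)
      simp only [Equiv.Perm.mul_apply, a1, b1, a2, b2] at h0
      rw [Nat.zero_add, Nat.zero_add, add_comm u2 u1] at h0
      omega
    · intro h q hq
      rw [← Nat.mod_eq_of_lt hq]
      simp only [Equiv.Perm.mul_apply, a1, b1, a2, b2]
      rw [key q h]
  have br : (C1 * C2 * C1 = C2 * C1 * C2) ↔ (t1 + t2) % m = (u1 + u2) % m := by
    constructor
    · intro h
      have h0 := congrArg (fun e : Equiv.Perm ℕ => e (1 + (b + m) + 0 % m)) h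
      simp only [Equiv.Perm.mul_apply, a1, b1, a2, b2, f1, f2] at h0
      rw [Nat.zero_add, Nat.zero_add, add_comm u2 u1] at h0
      omega
    · intro h
      ext x
      simp only [Equiv.Perm.mul_apply]
      by_cases hx : 1 + b ≤ x ∧ x < 1 + b + m
      · obtain ⟨q, hq, rfl⟩ : ∃ q, q < m ∧ x = 1 + b + q := ⟨x - (1 + b), by omega, by omega⟩
        rw [← Nat.mod_eq_of_lt hq]
        simp only [a1, b1, a2, b2, f1, f2]
      by_cases hy : 1 + (b + m) ≤ x ∧ x < 1 + (b + m) + m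
      · obtain ⟨q, hq, rfl⟩ : ∃ q, q < m ∧ x = 1 + (b + m) + q :=
          ⟨x - (1 + (b + m)), by omega, by omega⟩
        rw [← Nat.mod_eq_of_lt hq]
        simp only [a1, b1, a2, b2, f1, f2]
        rw [key q h]
      by_cases hz : 1 + (b + m + m) ≤ x ∧ x < 1 + (b + m + m) + m
      · obtain ⟨q, hq, rfl⟩ : ∃ q, q < m ∧ x = 1 + (b + m + m) + q :=
          ⟨x - (1 + (b + m + m)), by omega, by omega⟩
        rw [← Nat.mod_eq_of_lt hq]
        simp only [a1, b1, a2, b2, f1, f2]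
      have g1 : C1 x = x := hC1fix x (fun r hr => by constructor <;> omega)
      have g2 : C2 x = x := hC2fix x (fun r hr => by constructor <;> omega)
      simp only [g1, g2]
  exact ⟨br.trans sq.symm, br⟩
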